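/- (Escape/Escape.) Set δ = d_Esc·√(min(w/2,1/4)/(κ₀+1)). Then for every radially symmetric solution u, every ρ ≥ r_sc and every t > 0: if F₀(ρ,t) ≤ δ², then |u(ρ,t)| ≤ d_Esc. -/

import Mathlib

open Filter Topology Set MeasureTheory

noncomputable section

local notation "⟪" x ", " y "⟫" => @inner ℝ _ _ x y

abbrev Euc (n : ℕ) : Type := EuclideanSpace ℝ (Fin n)

variable {n : ℕ}

/-- Spatial partial derivative `u_r`. -/
def ur (u : ℝ → ℝ → Euc n) (r t : ℝ) : Euc n := deriv (fun s => u s t) r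

/-- Second spatial partial derivative `u_rr`. -/
def urr (u : ℝ → ℝ → Euc n) (r t : ℝ) : Euc n := deriv (fun s => ur u s t) r

/-- Time partial derivative `u_t`. -/
def ut (u : ℝ → ℝ → Euc n) (r t : ℝ) : Euc n := deriv (fun s => u r s) t

/-- Hessian (second differential) of the potential. -/
def hess (V : Euc n → ℝ) (x : Euc n) : Euc n →L[ℝ] Euc n := fderiv ℝ (gradient V) x

/-- Coercivity hypothesis. -/
def HCoerc (V : Euc n → ℝ) : Prop :=
  ∃ ε > (0:ℝ), ∃ R : ℝ, ∀ x : Euc n, R ≤ ‖x‖ → ε * ‖x‖ ^ 2 ≤ ⟪x, gradient V x⟫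

/-- The set of nondegenerate minimum points of `V`. -/
def MinSet (V : Euc n → ℝ) : Set (Euc n) :=
  {m | gradient V m = 0 ∧ ∀ v : Euc n, v ≠ 0 → 0 < ⟪v, hess V m v⟫}

/-- Data of the constants `λ_min`, `λ_max`, `d_Esc` from the paper, together with their
spectral characterizations. -/
structure EscData (n : ℕ) (V : Euc n → ℝ) where
  lmin : ℝ
  lmax : ℝ
  dEsc : ℝ
  lmin_pos : 0 < lmin
  dEsc_pos : 0 < dEsc
  lower : ∀ m ∈ MinSet V, ∀ v : Euc n, lmin * ‖v‖ ^ 2 ≤ ⟪v, hess V m v⟫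
  upper : ∀ m ∈ MinSet V, ∀ v : Euc n, ⟪v, hess V m v⟫ ≤ lmax * ‖v‖ ^ 2
  esc_lower : ∀ m ∈ MinSet V, ∀ x : Euc n, ‖x - m‖ ≤ dEsc →
    ∀ v : Euc n, lmin / 2 * ‖v‖ ^ 2 ≤ ⟪v, hess V x v⟫
  esc_upper : ∀ m ∈ MinSet V, ∀ x : Euc n, ‖x - m‖ ≤ dEsc →
    ∀ v : Euc n, ⟪v, hess V x v⟫ ≤ 2 * lmax * ‖v‖ ^ 2

/-- Radially symmetric solution of `u_t = -∇V(u) + ((d-1)/r) u_r + u_rr` with Neumann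
boundary condition at the origin. -/
structure IsRadialSolution (d : ℕ) (V : Euc n → ℝ) (u : ℝ → ℝ → Euc n) : Prop where
  diff_r : ∀ t > (0:ℝ), ∀ r : ℝ, DifferentiableAt ℝ (fun s => u s t) r
  diff_rr : ∀ t > (0:ℝ), ∀ r : ℝ, DifferentiableAt ℝ (fun s => ur u s t) r
  cont_rr : ∀ t > (0:ℝ), Continuous fun r => urr u r t
  diff_t : ∀ t > (0:ℝ), ∀ r : ℝ, DifferentiableAt ℝ (fun s => u r s) t
  cont_t : ∀ r : ℝ, ContinuousOn (fun s => ut u r s) (Ioi 0)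
  bounded : ∃ C : ℝ, ∀ r t : ℝ, 0 ≤ r → 0 < t →
    ‖u r t‖ + ‖ur u r t‖ + ‖urr u r t‖ + ‖ut u r t‖ ≤ C
  pde : ∀ r > (0:ℝ), ∀ t > (0:ℝ),
    ut u r t = -gradient V (u r t) + (((d : ℝ) - 1) / r) • ur u r t + urr u r t
  neumann : ∀ t > (0:ℝ), ur u 0 t = 0

/-- Profiles of fronts travelling at speed `c` connecting `um` to `up`
(nonconstant solutions of `φ'' = -cφ' + ∇V(φ)`). -/
def Phi (V : Euc n → ℝ) (c : ℝ) (um up : Euc n) : Set (ℝ → Euc n) :=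
  {φ | (∃ ξ₁ ξ₂ : ℝ, φ ξ₁ ≠ φ ξ₂) ∧
    (∀ ξ : ℝ, DifferentiableAt ℝ φ ξ) ∧ (∀ ξ : ℝ, DifferentiableAt ℝ (deriv φ) ξ) ∧
    (∀ ξ : ℝ, deriv (deriv φ) ξ = -(c • deriv φ ξ) + gradient V (φ ξ)) ∧
    Tendsto φ atBot (𝓝 um) ∧ Tendsto φ atTop (𝓝 up)}

/-- Fronts travelling at speed `c` invading the equilibrium `mp`. -/
def PhiInv (V : Euc n → ℝ) (c : ℝ) (mp : Euc n) : Set (ℝ → Euc n) :=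
  ⋃ mm ∈ MinSet V, Phi V c mm mp

/-- Normalized front profiles. -/
def PhiNorm (V : Euc n → ℝ) (dEsc c : ℝ) (mm mp : Euc n) : Set (ℝ → Euc n) :=
  {φ | φ ∈ Phi V c mm mp ∧ ‖φ 0 - mp‖ = dEsc ∧ ∀ ξ > (0:ℝ), ‖φ ξ - mp‖ < dEsc}

/-- Normalized front profiles invading `mp`. -/
def PhiNormInv (V : Euc n → ℝ) (dEsc c : ℝ) (mp : Euc n) : Set (ℝ → Euc n) :=
  ⋃ mm ∈ MinSet V, PhiNorm V dEsc c mm mp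

/-- Every critical point of `V` is nondegenerate. -/
def HNonDeg (V : Euc n → ℝ) : Prop :=
  ∀ x : Euc n, gradient V x = 0 → ∀ v : Euc n, hess V x v = 0 → v = 0

/-- Every front travelling at a positive speed and invading a minimum point is bistable. -/
def HOnlyBist (V : Euc n → ℝ) : Prop :=
  ∀ mp ∈ MinSet V, ∀ um : Euc n, gradient V um = 0 →
    ∀ c > (0:ℝ), (Phi V c um mp).Nonempty → um ∈ MinSet V

/-- The set of invading speeds has empty interior. -/
def HDiscVel (V : Euc n → ℝ) : Prop :=
  ∀ mp ∈ MinSet V, interior {c : ℝ | 0 ≤ c ∧ (PhiInv V c mp).Nonempty} = ∅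

/-- The set of initial values of normalized invading fronts is totally disconnected. -/
def HDiscFront (V : Euc n → ℝ) (dEsc : ℝ) : Prop :=
  ∀ mp ∈ MinSet V, ∀ c > (0:ℝ),
    IsTotallyDisconnected
      {p : Euc n × Euc n | ∃ φ ∈ PhiNormInv V dEsc c mp, p = (φ 0, deriv φ 0)}

/-- The generic hypotheses on the potential. -/
def HGen (V : Euc n → ℝ) (dEsc : ℝ) : Prop :=
  HNonDeg V ∧ HOnlyBist V ∧ HDiscVel V ∧ HDiscFront V dEsc

/-- The solution is stable at infinity, close to the minimum point `m`. -/
def StableAtInfinity (V : Euc n → ℝ) (u : ℝ → ℝ → Euc n) (m : Euc n) : Prop :=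
  m ∈ MinSet V ∧
    Tendsto (fun t => limsup (fun r => ‖u r t - m‖) atTop) atTop (𝓝 0)

/-- Propagating terrace of bistable fronts connecting `mLoc` to `mFar`. -/
def IsTerrace (V : Euc n → ℝ) (mLoc mFar : Euc n) (T : ℝ → ℝ → Euc n) : Prop :=
  ∃ (q : ℕ) (ms : ℕ → Euc n) (cs : ℕ → ℝ) (φs : ℕ → ℝ → Euc n) (rs : ℕ → ℝ → ℝ),
    ms 0 = mFar ∧ ms q = mLoc ∧ (∀ i, i ≤ q → ms i ∈ MinSet V) ∧
    (∀ i, i < q → V (ms (i + 1)) < V (ms i)) ∧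
    (∀ i, 1 ≤ i → i ≤ q → 0 < cs i) ∧
    (∀ i, 1 ≤ i → i + 1 ≤ q → cs (i + 1) ≤ cs i) ∧
    (∀ i, 1 ≤ i → i ≤ q → φs i ∈ Phi V (cs i) (ms i) (ms (i - 1))) ∧
    (∀ i, 1 ≤ i → i ≤ q →
      (∀ t : ℝ, 0 ≤ t → 0 ≤ rs i t) ∧ (∀ t : ℝ, DifferentiableAt ℝ (rs i) t) ∧
        Tendsto (deriv (rs i)) atTop (𝓝 (cs i))) ∧
    (∀ i, 1 ≤ i → i + 1 ≤ q → Tendsto (fun t => rs (i + 1) t - rs i t) atTop atTop) ∧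
    (∀ r t : ℝ, 0 ≤ r → 0 ≤ t →
      T r t = ms 0 + ∑ i ∈ Finset.Icc 1 q, (φs i (r - rs i t) - ms (i - 1)))

/-- Hypothesis `(H_hom)` unbundled: `u` is close to `m` on a growing interval around
`rHom t`, travelling at asymptotic speed `cHom`; closeness is measured in `H¹` norm. -/
def HHomWith (u : ℝ → ℝ → Euc n) (m : Euc n) (cHom : ℝ) (rHom : ℝ → ℝ) : Prop :=
  0 < cHom ∧ (∀ t : ℝ, DifferentiableAt ℝ rHom t) ∧
    Tendsto (deriv rHom) atTop (𝓝 cHom) ∧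
    ∀ L > (0:ℝ),
      Tendsto
        (fun t => ∫ r in (-L)..L,
          (‖u (rHom t + r) t - m‖ ^ 2 + ‖ur u (rHom t + r) t‖ ^ 2))
        atTop (𝓝 0)

/-- The set whose supremum defines the Escape point `r_Esc(t)`. -/
def rEscSet (u : ℝ → ℝ → Euc n) (m : Euc n) (dEsc : ℝ) (rHom : ℝ → ℝ) (t : ℝ) : Set ℝ :=
  {r | r ∈ Icc 0 (rHom t) ∧ ‖u r t - m‖ = dEsc}

/-- The Escape point `r_Esc(t)`. -/
def rEscF (u : ℝ → ℝ → Euc n) (m : Euc n) (dEsc : ℝ) (rHom : ℝ → ℝ) (t : ℝ) : ℝ :=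
  sSup (rEscSet u m dEsc rHom t)

/-- The upper limit mean speed `c_Esc` of the Escape point. -/
def cEscV (u : ℝ → ℝ → Euc n) (m : Euc n) (dEsc : ℝ) (rHom : ℝ → ℝ) : ℝ :=
  limsup (fun t => rEscF u m dEsc rHom t / t) atTop

/-- `q_hull`: minimal convexity of the lower quadratic hulls of `V` at minimum points. -/
def qHull (V : Euc n → ℝ) : ℝ :=
  sInf {q : ℝ | ∃ m ∈ MinSet V, ∃ x : Euc n, x ≠ m ∧ q = (V x - V m) / ‖x - m‖ ^ 2}

/-- The weight `w` of the energy in the firewall functionals. -/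
def wV (V : Euc n → ℝ) : ℝ := 1 / max 1 (-(4 * qHull V))

/-- The decay rate `κ₀`. -/
def kappa0 (lmin : ℝ) : ℝ := min (1 / 2) (lmin / 8)

/-- The "small curvature" radius `r_sc`. -/
def rsc (d : ℕ) (lmin : ℝ) : ℝ := max (2 * ((d : ℝ) - 1)) (8 * ((d : ℝ) - 1) / lmin)

/-- The weight function `T_ρ ψ₀`. -/
def Tpsi (d : ℕ) (lmin : ℝ) (ρ r : ℝ) : ℝ :=
  if r ≤ rsc d lmin then Real.exp (-(kappa0 lmin) * |r - ρ|) * (r / rsc d lmin) ^ (d - 1)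
  else Real.exp (-(kappa0 lmin) * |r - ρ|)

/-- The firewall functional `F₀` in the laboratory frame. -/
def F0 (V : Euc n → ℝ) (d : ℕ) (lmin : ℝ) (u : ℝ → ℝ → Euc n) (ρ t : ℝ) : ℝ :=
  ∫ r in Ioi (0:ℝ),
    Tpsi d lmin ρ r * (wV V * (‖ur u r t‖ ^ 2 / 2 + V (u r t)) + ‖u r t‖ ^ 2 / 2)

/-- The set `Σ₀(t)` where the solution Escapes at distance `dEsc` from the origin. -/
def Sigma0 (u : ℝ → ℝ → Euc n) (dEsc t : ℝ) : Set ℝ := {r | 0 ≤ r ∧ dEsc < ‖u r t‖}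

/-- The firewall differential inequality in the laboratory frame. -/
def FireIneq (V : Euc n → ℝ) (d : ℕ) (lmin dEsc : ℝ) (u : ℝ → ℝ → Euc n) (ν K : ℝ) : Prop :=
  ∀ ρ ≥ rsc d lmin, ∀ t > (0:ℝ),
    DifferentiableAt ℝ (fun s => F0 V d lmin u ρ s) t ∧
    deriv (fun s => F0 V d lmin u ρ s) t ≤
      -ν * F0 V d lmin u ρ t + K * ∫ r in Sigma0 u dEsc t, Tpsi d lmin ρ r

/-- The quantity `δ = d_Esc √(min(w/2,1/4)/(κ₀+1))`. -/
def deltaEsc (dEsc w κ₀ : ℝ) : ℝ := dEsc * Real.sqrt (min (w / 2) (1 / 4) / (κ₀ + 1))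

/-- The length `L₀`. -/
def L0c (κ₀ ν K δ : ℝ) : ℝ := κ₀⁻¹ * Real.log (16 * K / (ν * δ ^ 2 * κ₀))

/-- The no-escape speed `c_noesc`. -/
def cNoEsc (κ₀ K L₀ δ : ℝ) : ℝ := 8 * K * L₀ / (κ₀ * δ ^ 2)

/-- The no-escape hull `h`. -/
def hull (δ L₀ : ℝ) (x : ℝ) : EReal :=
  if x < 0 then ⊤
  else if x ≤ L₀ then ((δ ^ 2 / 2 * (1 - x / (2 * L₀)) : ℝ) : EReal)
  else ((δ ^ 2 / 4 : ℝ) : EReal)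

/-- The standing hypothesis that the firewall is below the two mirror hulls positioned
around `rHom t`. -/
def HullBound (V : Euc n → ℝ) (d : ℕ) (lmin : ℝ) (u : ℝ → ℝ → Euc n) (δ L₀ : ℝ)
    (rHom : ℝ → ℝ) : Prop :=
  ∀ t ≥ (0:ℝ), rsc d lmin ≤ rHom t - 1 ∧
    ∀ r ≥ rsc d lmin, ((F0 V d lmin u r t : ℝ) : EReal) ≤
      max (hull δ L₀ (r - (rHom t - 1))) (hull δ L₀ (rHom t - r))

/-- The set whose infimum defines the escape point `r_esc(t)`. -/
def rescSet (V : Euc n → ℝ) (d : ℕ) (lmin : ℝ) (u : ℝ → ℝ → Euc n) (δ L₀ : ℝ)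
    (rHom : ℝ → ℝ) (t : ℝ) : Set ℝ :=
  {rl | rl ∈ Icc (rsc d lmin) (rHom t) ∧
    ∀ r ≥ rsc d lmin, ((F0 V d lmin u r t : ℝ) : EReal) ≤
      max (hull δ L₀ (r - rl)) (hull δ L₀ (rHom t - r))}

/-- The escape point `r_esc(t)`. -/
def rescF (V : Euc n → ℝ) (d : ℕ) (lmin : ℝ) (u : ℝ → ℝ → Euc n) (δ L₀ : ℝ)
    (rHom : ℝ → ℝ) (t : ℝ) : ℝ :=
  sInf (rescSet V d lmin u δ L₀ rHom t)

/-- `c̄`: upper limit of mean variations of a function over time intervals of length `s`. -/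
def cbarF (f : ℝ → ℝ) : ℝ :=
  limsup (fun s => sSup {x : ℝ | ∃ t ≥ (0:ℝ), x = f (t + s) - f t} / s) atTop

/-- `c̲`: lower limit of mean variations of a function over time intervals of length `s`. -/
def cunderF (f : ℝ → ℝ) : ℝ :=
  liminf (fun s => sInf {x : ℝ | ∃ t ≥ (0:ℝ), x = f (t + s) - f t} / s) atTop

/-- The decay rate `κ` in the travelling frame. -/
def kappaTF (lmin cno : ℝ) : ℝ := min (1 / 4) (lmin / (16 * (cno + 1)))

/-- The cut-off speed `c_cut` in the travelling frame. -/
def ccutTF (lmin lmax cno : ℝ) : ℝ := min (lmin / (8 * lmax)) (lmin / (8 * (cno + 1)))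

/-- The energy weight `w'` in the travelling frame. -/
def wTF (V : Euc n → ℝ) (cno : ℝ) : ℝ := min (wV V) (1 / (cno + 1) ^ 2)

/-- The weight function `χ` of the localized energy in the travelling frame. -/
def chiTF (d : ℕ) (lmin lmax cno c xcut r0 : ℝ) (ρ s : ℝ) : ℝ :=
  if ρ ≤ -r0 - c * s + rsc d lmin then
    Real.exp (c * ρ) * ((r0 + c * s + ρ) / rsc d lmin) ^ (d - 1)
  else if ρ ≤ xcut + ccutTF lmin lmax cno * s then Real.exp (c * ρ)
  else
    Real.exp ((c + kappaTF lmin cno) * (xcut + ccutTF lmin lmax cno * s) -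
      kappaTF lmin cno * ρ)

/-- The weight function `ψ` of the firewall in the travelling frame. -/
def psiTF (d : ℕ) (lmin lmax cno c xcut r0 : ℝ) (ρ s : ℝ) : ℝ :=
  if ρ ≤ -r0 - c * s + rsc d lmin then
    Real.exp ((c + kappaTF lmin cno) * ρ -
        kappaTF lmin cno * (xcut + ccutTF lmin lmax cno * s)) *
      ((r0 + c * s + ρ) / rsc d lmin) ^ (d - 1)
  else if ρ ≤ xcut + ccutTF lmin lmax cno * s then
    Real.exp ((c + kappaTF lmin cno) * ρ -
      kappaTF lmin cno * (xcut + ccutTF lmin lmax cno * s))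
  else
    Real.exp ((c + kappaTF lmin cno) * (xcut + ccutTF lmin lmax cno * s) -
      kappaTF lmin cno * ρ)

/-- The firewall functional `F(s)` in the travelling frame. -/
def FTF (V : Euc n → ℝ) (d : ℕ) (lmin lmax cno : ℝ) (u : ℝ → ℝ → Euc n)
    (t0 c xcut r0 : ℝ) (s : ℝ) : ℝ :=
  ∫ ρ in Ioi (-r0 - c * s),
    psiTF d lmin lmax cno c xcut r0 ρ s *
      (wTF V cno *
          (‖ur u (r0 + c * s + ρ) (t0 + s)‖ ^ 2 / 2 + V (u (r0 + c * s + ρ) (t0 + s))) +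
        ‖u (r0 + c * s + ρ) (t0 + s)‖ ^ 2 / 2)

/-- The set `Σ(s)` where the solution Escapes, in the travelling frame. -/
def SigmaTF (u : ℝ → ℝ → Euc n) (d : ℕ) (lmin dEsc : ℝ) (t0 c r0 : ℝ) (s : ℝ) : Set ℝ :=
  {ρ | -r0 - c * s + rsc d lmin ≤ ρ ∧ dEsc < ‖u (r0 + c * s + ρ) (t0 + s)‖}

/-- The weight function `ψ̃` in the standing frame. -/
def psiSF (d : ℕ) (κ cm cp : ℝ) (r t : ℝ) : ℝ :=
  if r ≤ cm * t then r ^ (d - 1) * Real.exp (-κ * (cm * t - r))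
  else if r ≤ cp * t then r ^ (d - 1)
  else r ^ (d - 1) * Real.exp (-κ * (r - cp * t))

/-- The firewall functional `F̃` in the standing frame. -/
def FSF (V : Euc n → ℝ) (d : ℕ) (κ cm cp : ℝ) (u : ℝ → ℝ → Euc n) (t : ℝ) : ℝ :=
  ∫ r in Ioi (0:ℝ),
    psiSF d κ cm cp r t * (wV V * (‖ur u r t‖ ^ 2 / 2 + V (u r t)) + ‖u r t‖ ^ 2 / 2)

/-- The quantity `δ_dissip(t)` measuring the dissipation around the escape point. -/
def deltaDissip (u : ℝ → ℝ → Euc n) (re : ℝ → ℝ) (cesc : ℝ) (t : ℝ) : ℝ :=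
  sInf {ε : ℝ | 0 < ε ∧
    (∫ τ in (-1:ℝ)..1, ∫ ρ in (-(1/ε))..(1/ε),
      ‖ut u (re (t + τ) + ρ) (t + τ) + cesc • ur u (re (t + τ) + ρ) (t + τ)‖ ^ 2) ≤ ε}

/-- `u` solves the radially symmetric system with initial datum `u₀`, in the sense of the
semi-flow on bounded continuous functions (classical for positive times). -/
def SolvesWithInit (d : ℕ) (V : Euc n → ℝ) (u : ℝ → ℝ → Euc n) (u₀ : ℝ → Euc n) : Prop :=
  (∀ r : ℝ, 0 ≤ r → u r 0 = u₀ r) ∧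
  (∀ t : ℝ, 0 ≤ t → ContinuousOn (fun r => u r t) (Ici 0) ∧ ∃ C, ∀ r : ℝ, 0 ≤ r → ‖u r t‖ ≤ C) ∧
  (∀ t : ℝ, 0 ≤ t → ∀ ε > (0:ℝ), ∃ δ > (0:ℝ), ∀ t' : ℝ, 0 ≤ t' → |t' - t| ≤ δ →
    ∀ r : ℝ, 0 ≤ r → ‖u r t' - u r t‖ ≤ ε) ∧
  (∀ t > (0:ℝ), ∀ r > (0:ℝ),
    DifferentiableAt ℝ (fun s => u s t) r ∧ DifferentiableAt ℝ (fun s => ur u s t) r) ∧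
  (∀ t > (0:ℝ), ∀ r : ℝ, 0 ≤ r → DifferentiableAt ℝ (fun s => u r s) t) ∧
  (∀ t > (0:ℝ), ∀ r > (0:ℝ),
    ut u r t = -gradient V (u r t) + (((d : ℝ) - 1) / r) • ur u r t + urr u r t) ∧
  (∀ t > (0:ℝ), DifferentiableAt ℝ (fun s => u s t) 0 ∧ ur u 0 t = 0)

theorem hasDerivAt_comp_add_smul {V : Euc n → ℝ} (hV : Differentiable ℝ V) (a v : Euc n)
    (s : ℝ) : HasDerivAt (fun s : ℝ => V (a + s • v)) ⟪v, gradient V (a + s • v)⟫ s := by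
  have h1 : HasDerivAt (fun s : ℝ => a + s • v) v s := by
    simpa using ((hasDerivAt_id s).smul_const v).const_add a
  have h2 := (hV (a + s • v)).hasGradientAt.hasFDerivAt.comp_hasDerivAt s h1
  rwa [InnerProductSpace.toDual_apply_apply, real_inner_comm] at h2

theorem bddBelow_range_of_hCoerc {V : Euc n → ℝ} (hV : Differentiable ℝ V) (hc : HCoerc V) :
    ∃ B, ∀ x, B ≤ V x := by
  obtain ⟨ε, hε, R, hR⟩ := hc
  set S := max R 1
  have hS1 : 1 ≤ S := le_max_right _ _
  have hcpt : IsCompact (Metric.closedBall (0 : Euc n) S) := isCompact_closedBall _ _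
  obtain ⟨B, hB⟩ := hcpt.bddBelow_image hV.continuous.continuousOn
  have hB' : ∀ x : Euc n, ‖x‖ ≤ S → B ≤ V x := fun x hx => hB ⟨x, by simpa using hx, rfl⟩
  refine ⟨B, fun x => ?_⟩
  rcases le_or_gt ‖x‖ S with hx | hx
  · exact hB' x hx
  have hx0 : 0 < ‖x‖ := by linarith
  have hder := hasDerivAt_comp_add_smul hV 0 x
  have hmono : MonotoneOn (fun s : ℝ => V (0 + s • x)) (Icc (S / ‖x‖) 1) := by
    refine monotoneOn_of_deriv_nonneg (convex_Icc _ _)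
      (fun s _ => (hder s).continuousAt.continuousWithinAt)
      (fun s _ => (hder s).differentiableAt.differentiableWithinAt) fun s hs => ?_
    rw [interior_Icc] at hs
    have hs0 : 0 < s := lt_trans (by positivity) hs.1
    have hsR : R ≤ ‖s • x‖ := by
      rw [norm_smul, Real.norm_of_nonneg hs0.le]
      have := (div_lt_iff₀ hx0).1 hs.1
      exact (le_max_left R 1).trans this.le
    have h := hR _ hsR
    rw [(hder s).deriv, zero_add]
    rw [real_inner_smul_left] at h
    have : 0 ≤ s * ⟪x, gradient V (s • x)⟫ := le_trans (by positivity) h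
    exact nonneg_of_mul_nonneg_right this hs0
  have hle : S / ‖x‖ ≤ 1 := (div_le_one hx0).2 hx.le
  have := hmono (left_mem_Icc.2 hle) (right_mem_Icc.2 hle) hle
  simp only [zero_add, one_smul] at this
  refine le_trans (hB' _ ?_) this
  rw [norm_smul, Real.norm_of_nonneg (by positivity), div_mul_cancel₀ _ hx0.ne']

theorem differentiable_gradient {V : Euc n → ℝ} (hV : ContDiff ℝ 2 V) :
    Differentiable ℝ (gradient V) := by
  have h : Differentiable ℝ (fderiv ℝ V) :=
    (hV.fderiv_right (m := 1) (by norm_num)).differentiable (by norm_num)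
  exact (InnerProductSpace.toDual ℝ (Euc n)).symm.toContinuousLinearEquiv.differentiable.comp h

theorem EscData.le_of_norm_sub_le {V : Euc n → ℝ} (D : EscData n V) (hV : ContDiff ℝ 2 V)
    {m x : Euc n} (hm : m ∈ MinSet V) (hx : ‖x - m‖ ≤ D.dEsc) : V m ≤ V x := by
  set v := x - m with hv
  have hgrad : ∀ s : ℝ, HasDerivAt (fun s : ℝ => ⟪v, gradient V (m + s • v)⟫)
      ⟪v, hess V (m + s • v) v⟫ s := fun s => by
    have h1 : HasDerivAt (fun s : ℝ => m + s • v) v s := by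
      simpa using ((hasDerivAt_id s).smul_const v).const_add m
    have h2 := (differentiable_gradient hV (m + s • v)).hasFDerivAt.comp_hasDerivAt s h1
    simpa [hess] using (hasDerivAt_const s v).inner ℝ h2
  have hder := hasDerivAt_comp_add_smul (hV.differentiable (by norm_num)) m v
  have hmono1 : MonotoneOn (fun s : ℝ => ⟪v, gradient V (m + s • v)⟫) (Icc 0 1) := by
    refine monotoneOn_of_deriv_nonneg (convex_Icc _ _)
      (fun s _ => (hgrad s).continuousAt.continuousWithinAt)
      (fun s _ => (hgrad s).differentiableAt.differentiableWithinAt) fun s hs => ?_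
    rw [interior_Icc] at hs
    rw [(hgrad s).deriv]
    refine le_trans ?_ (D.esc_lower m hm _ ?_ v)
    · have := D.lmin_pos
      positivity
    · rw [add_sub_cancel_left, norm_smul, Real.norm_of_nonneg hs.1.le]
      exact (mul_le_of_le_one_left (norm_nonneg v) hs.2.le).trans hx
  have hmono2 : MonotoneOn (fun s : ℝ => V (m + s • v)) (Icc 0 1) := by
    refine monotoneOn_of_deriv_nonneg (convex_Icc _ _)
      (fun s _ => (hder s).continuousAt.continuousWithinAt)
      (fun s _ => (hder s).differentiableAt.differentiableWithinAt) fun s hs => ?_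
    rw [interior_Icc] at hs
    rw [(hder s).deriv]
    have := hmono1 (left_mem_Icc.2 zero_le_one) (Ioo_subset_Icc_self hs) hs.1.le
    simpa [hm.1] using this
  have := hmono2 (left_mem_Icc.2 zero_le_one) (right_mem_Icc.2 zero_le_one) zero_le_one
  simpa [hv] using this

theorem bddAbove_image_minSet {V : Euc n → ℝ} (hV : Continuous V) (hc : HCoerc V) :
    ∃ A, ∀ m ∈ MinSet V, V m ≤ A := by
  obtain ⟨ε, hε, R, hR⟩ := hc
  have hcpt : IsCompact (Metric.closedBall (0 : Euc n) (max R 0)) := isCompact_closedBall _ _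
  obtain ⟨A, hA⟩ := hcpt.bddAbove_image hV.continuousOn
  refine ⟨A, fun m hm => hA ⟨m, ?_, rfl⟩⟩
  rw [mem_closedBall_zero_iff]
  by_contra! h
  have h1 := hR m ((le_max_left _ _).trans h.le)
  rw [hm.1, inner_zero_right] at h1
  have h2 : 0 < ‖m‖ := (le_max_right R 0).trans_lt h
  have : 0 < ε * ‖m‖ ^ 2 := by positivity
  linarith

theorem EscData.qHull_mul_norm_sq_le {V : Euc n → ℝ} (D : EscData n V) (hV : ContDiff ℝ 2 V)
    (hc : HCoerc V) {m : Euc n} (hm : m ∈ MinSet V) (x : Euc n) :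
    qHull V * ‖x - m‖ ^ 2 ≤ V x - V m := by
  obtain ⟨B, hB⟩ := bddBelow_range_of_hCoerc (hV.differentiable (by norm_num)) hc
  obtain ⟨A, hA⟩ := bddAbove_image_minSet hV.continuous hc
  have hbdd : BddBelow {q : ℝ | ∃ m ∈ MinSet V, ∃ x : Euc n, x ≠ m ∧
      q = (V x - V m) / ‖x - m‖ ^ 2} := by
    refine ⟨-(|B - A| / D.dEsc ^ 2), ?_⟩
    rintro q ⟨m, hm, x, -, rfl⟩
    have hd := D.dEsc_pos
    rcases le_or_gt ‖x - m‖ D.dEsc with hx | hx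
    · have h1 := D.le_of_norm_sub_le hV hm hx
      have h2 : 0 ≤ (V x - V m) / ‖x - m‖ ^ 2 := div_nonneg (by linarith) (by positivity)
      have h3 : 0 ≤ |B - A| / D.dEsc ^ 2 := by positivity
      linarith
    · have h1 : |B - A| / ‖x - m‖ ^ 2 ≤ |B - A| / D.dEsc ^ 2 := by gcongr
      have h2 : -|B - A| / ‖x - m‖ ^ 2 ≤ (V x - V m) / ‖x - m‖ ^ 2 := by
        gcongr
        linarith [neg_abs_le (B - A), hB x, hA m hm]
      rw [neg_div] at h2
      linarith
  rcases eq_or_ne x m with rfl | hx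
  · simp
  have hpos : 0 < ‖x - m‖ ^ 2 := by
    have := norm_pos_iff.2 (sub_ne_zero.2 hx)
    positivity
  exact (le_div_iff₀ hpos).1 (csInf_le hbdd ⟨m, hm, x, hx, rfl⟩)

theorem wV_pos (V : Euc n → ℝ) : 0 < wV V :=
  one_div_pos.2 (lt_max_of_lt_left one_pos)

theorem neg_quarter_le_wV_mul_qHull (V : Euc n → ℝ) : -(1 / 4) ≤ wV V * qHull V := by
  have h1 : wV V * max 1 (-(4 * qHull V)) = 1 :=
    one_div_mul_cancel (lt_max_of_lt_left one_pos).ne'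
  have h2 := mul_le_mul_of_nonneg_left (le_max_right 1 (-(4 * qHull V))) (wV_pos V).le
  linarith

theorem rsc_pos {d : ℕ} (hd : 2 ≤ d) (l : ℝ) : 0 < rsc d l := by
  have : (2 : ℝ) ≤ d := by exact_mod_cast hd
  exact lt_max_of_lt_left (by linarith)

theorem kappa0_pos {l : ℝ} (hl : 0 < l) : 0 < kappa0 l :=
  lt_min (by norm_num) (by positivity)

theorem Tpsi_nonneg {d : ℕ} (hd : 2 ≤ d) (l ρ : ℝ) {r : ℝ} (hr : 0 ≤ r) : 0 ≤ Tpsi d l ρ r := by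
  have := rsc_pos hd l
  unfold Tpsi
  split_ifs <;> positivity

theorem Tpsi_le {d : ℕ} (hd : 2 ≤ d) {l : ℝ} (hl : 0 < l) (ρ : ℝ) {r : ℝ} (hr : 0 ≤ r) :
    Tpsi d l ρ r ≤ Real.exp (kappa0 l * ρ) * Real.exp (-kappa0 l * r) := by
  have hs := rsc_pos hd l
  have hκ := kappa0_pos hl
  have hexp : Real.exp (-(kappa0 l) * |r - ρ|) ≤
      Real.exp (kappa0 l * ρ) * Real.exp (-kappa0 l * r) := by
    rw [← Real.exp_add]
    gcongr
    nlinarith [le_abs_self (r - ρ)]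
  unfold Tpsi
  split_ifs with h
  · refine le_trans (mul_le_of_le_one_right (Real.exp_pos _).le ?_) hexp
    exact pow_le_one₀ (by positivity) ((div_le_one hs).2 h)
  · exact hexp

theorem Tpsi_of_le {d : ℕ} (l : ℝ) {ρ r : ℝ} (hρ : rsc d l ≤ ρ) (hr : ρ < r) :
    Tpsi d l ρ r = Real.exp (-kappa0 l * (r - ρ)) := by
  rw [Tpsi, if_neg (by linarith), abs_of_pos (by linarith)]

theorem measurable_Tpsi (d : ℕ) (l ρ : ℝ) : Measurable (Tpsi d l ρ) := by
  unfold Tpsi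
  exact Measurable.ite measurableSet_Iic (by fun_prop) (by fun_prop)

theorem integrableOn_Tpsi {d : ℕ} (hd : 2 ≤ d) {l : ℝ} (hl : 0 < l) (ρ : ℝ) :
    IntegrableOn (Tpsi d l ρ) (Ioi 0) := by
  refine Integrable.mono' ((exp_neg_integrableOn_Ioi 0 (kappa0_pos hl)).const_mul
    (Real.exp (kappa0 l * ρ))) (measurable_Tpsi d l ρ).aestronglyMeasurable ?_
  filter_upwards [ae_restrict_mem measurableSet_Ioi] with r hr
  rw [Real.norm_of_nonneg (Tpsi_nonneg hd l ρ (le_of_lt hr))]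
  exact Tpsi_le hd hl ρ (le_of_lt hr)

/-- Weighted trace inequality on a half-line. -/
theorem norm_sq_le_integral_exp_mul {E : Type*} [NormedAddCommGroup E] [InnerProductSpace ℝ E]
    {f f' : ℝ → E} {κ ρ C : ℝ} (hκ : 0 < κ) (hf : ∀ r, HasDerivAt f (f' r) r)
    (hf' : Continuous f') (hC : ∀ r, ρ ≤ r → ‖f r‖ ≤ C) (hC' : ∀ r, ρ ≤ r → ‖f' r‖ ≤ C) :
    IntegrableOn (fun r => Real.exp (-κ * (r - ρ)) * (‖f' r‖ ^ 2 + ‖f r‖ ^ 2)) (Ioi ρ) ∧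
    ‖f ρ‖ ^ 2 ≤
      (κ + 1) * ∫ r in Ioi ρ, Real.exp (-κ * (r - ρ)) * (‖f' r‖ ^ 2 + ‖f r‖ ^ 2) := by
  have hfc : Continuous f := continuous_iff_continuousAt.2 fun r => (hf r).continuousAt
  have hC0 : 0 ≤ C := (norm_nonneg _).trans (hC ρ le_rfl)
  have hexp : ∀ r, Real.exp (-κ * (r - ρ)) = Real.exp (κ * ρ) * Real.exp (-κ * r) := fun r => by
    rw [← Real.exp_add]; ring_nf
  have hInt : IntegrableOn (fun r => Real.exp (-κ * (r - ρ))) (Ioi ρ) := by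
    simp_rw [hexp]
    exact (exp_neg_integrableOn_Ioi ρ hκ).const_mul _
  have hI : IntegrableOn (fun r => Real.exp (-κ * (r - ρ)) * (‖f' r‖ ^ 2 + ‖f r‖ ^ 2))
      (Ioi ρ) := by
    refine Integrable.mul_bdd (c := C ^ 2 + C ^ 2) hInt
      (by fun_prop : Continuous _).aestronglyMeasurable ?_
    filter_upwards [ae_restrict_mem measurableSet_Ioi] with r hr
    rw [Real.norm_of_nonneg (by positivity)]
    gcongr
    exacts [hC' r (le_of_lt hr), hC r (le_of_lt hr)]
  have hinner : ∀ r, |⟪f r, f' r⟫| ≤ ‖f r‖ * ‖f' r‖ := fun r => abs_real_inner_le_norm _ _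
  have hder : ∀ r, HasDerivAt (fun r => Real.exp (-κ * (r - ρ)) * ‖f r‖ ^ 2)
      (Real.exp (-κ * (r - ρ)) * (2 * ⟪f r, f' r⟫ - κ * ‖f r‖ ^ 2)) r := fun r => by
    have h1 : HasDerivAt (fun r => -κ * (r - ρ)) (-κ) r := by
      simpa using ((hasDerivAt_id r).sub_const ρ).const_mul (-κ)
    refine (h1.exp.mul (hf r).norm_sq).congr_deriv ?_
    ring
  have hI' : IntegrableOn (fun r => Real.exp (-κ * (r - ρ)) *
      (2 * ⟪f r, f' r⟫ - κ * ‖f r‖ ^ 2)) (Ioi ρ) := by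
    refine Integrable.mono' (hI.const_mul (κ + 1))
      (by fun_prop : Continuous _).aestronglyMeasurable ?_
    filter_upwards with r
    rw [norm_mul, Real.norm_of_nonneg (Real.exp_pos _).le, mul_left_comm]
    gcongr
    rw [Real.norm_eq_abs, abs_le]
    have := abs_le.1 (hinner r)
    constructor <;> nlinarith [sq_nonneg (‖f r‖ - ‖f' r‖), sq_nonneg ‖f' r‖, sq_nonneg ‖f r‖,
      mul_nonneg hκ.le (sq_nonneg ‖f' r‖), mul_nonneg hκ.le (sq_nonneg ‖f r‖)]
  have hlim : Tendsto (fun r => Real.exp (-κ * (r - ρ)) * ‖f r‖ ^ 2) atTop (𝓝 0) := by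
    have h0 : Tendsto (fun r => Real.exp (-κ * (r - ρ)) * C ^ 2) atTop (𝓝 0) := by
      have h1 : Tendsto (fun r : ℝ => κ * (r - ρ)) atTop atTop :=
        (tendsto_atTop_add_const_right _ (-ρ) tendsto_id).const_mul_atTop hκ
      have h2 := (Real.tendsto_exp_neg_atTop_nhds_zero.comp h1).mul_const (C ^ 2)
      simpa [Function.comp_def] using h2
    refine tendsto_of_tendsto_of_tendsto_of_le_of_le' tendsto_const_nhds h0
      (Eventually.of_forall fun r => by positivity) ?_
    filter_upwards [eventually_ge_atTop ρ] with r hr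
    gcongr
    exact hC r hr
  have hFTC := integral_Ioi_of_hasDerivAt_of_tendsto (hder ρ).continuousAt.continuousWithinAt
    (fun r _ => hder r) hI' hlim
  refine ⟨hI, ?_⟩
  simp only [sub_self, mul_zero, Real.exp_zero, one_mul, zero_sub] at hFTC
  rw [← neg_eq_iff_eq_neg] at hFTC
  rw [← hFTC, ← integral_neg, ← integral_const_mul]
  refine setIntegral_mono_on hI'.neg (hI.const_mul _) measurableSet_Ioi fun r _ => ?_
  rw [← mul_neg, mul_left_comm]
  gcongr
  have := abs_le.1 (hinner r)
  nlinarith [sq_nonneg (‖f r‖ - ‖f' r‖), mul_nonneg hκ.le (sq_nonneg ‖f' r‖)]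

/-- The firewall density controls the `H¹` density. -/
theorem EscData.firewall_density_lower_bound {V : Euc n → ℝ} (D : EscData n V)
    (hV : ContDiff ℝ 2 V) (hc : HCoerc V) (h0 : (0 : Euc n) ∈ MinSet V) (hV0 : V 0 = 0)
    (x p : Euc n) :
    min (wV V / 2) (1 / 4) * (‖p‖ ^ 2 + ‖x‖ ^ 2) ≤
      wV V * (‖p‖ ^ 2 / 2 + V x) + ‖x‖ ^ 2 / 2 := by
  have h1 := D.qHull_mul_norm_sq_le hV hc h0 x
  rw [sub_zero, hV0, sub_zero] at h1
  have h2 := mul_le_mul_of_nonneg_left h1 (wV_pos V).le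
  have h3 := mul_le_mul_of_nonneg_right (neg_quarter_le_wV_mul_qHull V) (sq_nonneg ‖x‖)
  have h4 := mul_le_mul_of_nonneg_right (min_le_left (wV V / 2) (1 / 4)) (sq_nonneg ‖p‖)
  have h5 := mul_le_mul_of_nonneg_right (min_le_right (wV V / 2) (1 / 4)) (sq_nonneg ‖x‖)
  nlinarith

theorem IsRadialSolution.integrableOn_firewall {d : ℕ} (hd : 2 ≤ d) {V : Euc n → ℝ}
    (hV : Continuous V) {u : ℝ → ℝ → Euc n} (hu : IsRadialSolution d V u) {l : ℝ} (hl : 0 < l)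
    (ρ : ℝ) {t : ℝ} (ht : 0 < t) :
    IntegrableOn (fun r => Tpsi d l ρ r *
      (wV V * (‖ur u r t‖ ^ 2 / 2 + V (u r t)) + ‖u r t‖ ^ 2 / 2)) (Ioi 0) := by
  obtain ⟨C, hC⟩ := hu.bounded
  have hcu : Continuous fun r => u r t :=
    continuous_iff_continuousAt.2 fun r => (hu.diff_r t ht r).continuousAt
  have hcur : Continuous fun r => ur u r t :=
    continuous_iff_continuousAt.2 fun r => (hu.diff_rr t ht r).continuousAt
  have hcpt : IsCompact (Metric.closedBall (0 : Euc n) C ×ˢ Metric.closedBall (0 : Euc n) C) :=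
    (isCompact_closedBall _ _).prod (isCompact_closedBall _ _)
  obtain ⟨A, hA⟩ := hcpt.exists_bound_of_continuousOn
    (f := fun z : Euc n × Euc n => wV V * (‖z.2‖ ^ 2 / 2 + V z.1) + ‖z.1‖ ^ 2 / 2)
    (by fun_prop : Continuous _).continuousOn
  refine Integrable.mul_bdd (c := A) (integrableOn_Tpsi hd hl ρ)
    (by fun_prop : Continuous _).aestronglyMeasurable ?_
  filter_upwards [ae_restrict_mem measurableSet_Ioi] with r hr
  have h := hC r t (le_of_lt hr) ht
  refine hA (u r t, ur u r t) ⟨?_, ?_⟩ <;> rw [mem_closedBall_zero_iff] <;>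
    linarith [norm_nonneg (u r t), norm_nonneg (ur u r t), norm_nonneg (urr u r t),
      norm_nonneg (ut u r t)]

/-- escape/Escape. -/
theorem stmt5 {n d k : ℕ} (hn : 1 ≤ n) (hd : 2 ≤ d) (hk : 2 ≤ k)
    (V : Euc n → ℝ) (hV : ContDiff ℝ (k : ℕ∞) V) (hcoerc : HCoerc V)
    (D : EscData n V) (h0 : (0 : Euc n) ∈ MinSet V) (hV0 : V 0 = 0)
    (u : ℝ → ℝ → Euc n) (hu : IsRadialSolution d V u) :
    ∀ ρ ≥ rsc d D.lmin, ∀ t > (0:ℝ),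
      F0 V d D.lmin u ρ t ≤ (deltaEsc D.dEsc (wV V) (kappa0 D.lmin)) ^ 2 →
      ‖u ρ t‖ ≤ D.dEsc := by
  intro ρ hρ t ht hF
  have hV2 : ContDiff ℝ 2 V := hV.of_le (by
    have h : ((2 : ℕ) : ℕ∞) ≤ (k : ℕ∞) := Nat.cast_le.2 hk
    exact WithTop.coe_le_coe.2 h)
  have hl := D.lmin_pos
  have hκ := kappa0_pos hl
  have hρ0 : 0 < ρ := (rsc_pos hd D.lmin).trans_le hρ
  set μ := min (wV V / 2) (1 / 4) with hμ
  have hμ0 : 0 < μ := lt_min (half_pos (wV_pos V)) (by norm_num)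
  obtain ⟨C, hC⟩ := hu.bounded
  obtain ⟨hI, htrace⟩ := norm_sq_le_integral_exp_mul (f := fun r => u r t)
    (f' := fun r => ur u r t) (ρ := ρ) (C := C) hκ (fun r => (hu.diff_r t ht r).hasDerivAt)
    (continuous_iff_continuousAt.2 fun r => (hu.diff_rr t ht r).continuousAt)
    (fun r hr => by
      linarith [hC r t (hρ0.le.trans hr) ht, norm_nonneg (ur u r t), norm_nonneg (urr u r t),
        norm_nonneg (ut u r t)])
    (fun r hr => by
      linarith [hC r t (hρ0.le.trans hr) ht, norm_nonneg (u r t), norm_nonneg (urr u r t),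
        norm_nonneg (ut u r t)])
  have hden := fun r => D.firewall_density_lower_bound hV2 hcoerc h0 hV0 (u r t) (ur u r t)
  have hInt := hu.integrableOn_firewall hd hV.continuous hl ρ ht
  have hlow : μ * ∫ r in Ioi ρ, Real.exp (-kappa0 D.lmin * (r - ρ)) *
      (‖ur u r t‖ ^ 2 + ‖u r t‖ ^ 2) ≤ F0 V d D.lmin u ρ t := by
    refine le_trans ?_ (setIntegral_mono_set hInt ?_ (Ioi_subset_Ioi hρ0.le).eventuallyLE)
    · rw [← integral_const_mul]
      refine setIntegral_mono_on (hI.const_mul μ) (hInt.mono_set (Ioi_subset_Ioi hρ0.le))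
        measurableSet_Ioi fun r hr => ?_
      rw [Tpsi_of_le D.lmin hρ hr, mul_left_comm]
      exact mul_le_mul_of_nonneg_left (hden r) (Real.exp_pos _).le
    · filter_upwards [ae_restrict_mem measurableSet_Ioi] with r hr
      exact mul_nonneg (Tpsi_nonneg hd _ ρ (le_of_lt hr))
        (le_trans (by positivity) (hden r))
  have hδ : deltaEsc D.dEsc (wV V) (kappa0 D.lmin) ^ 2 * (kappa0 D.lmin + 1) =
      μ * D.dEsc ^ 2 := by
    rw [deltaEsc, ← hμ, mul_pow, Real.sq_sqrt (by positivity)]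
    field_simp
  have hκ1 : 0 < kappa0 D.lmin + 1 := by linarith
  have hsq : μ * ‖u ρ t‖ ^ 2 ≤ μ * D.dEsc ^ 2 := by
    rw [← hδ]
    have h1 := mul_le_mul_of_nonneg_left htrace hμ0.le
    have h2 := mul_le_mul_of_nonneg_right (hlow.trans hF) hκ1.le
    linarith
  exact le_of_sq_le_sq (le_of_mul_le_mul_left hsq hμ0) D.dEsc_pos.le
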